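/- Let D, N ∈ ℕ with N ≥ 1, let λ > 0, and let i₁, …, i_N ∈ {1, …, D} be a sequence of coordinate indices. Then the function f(X) := ∏_{t=1}^{N} softmax(x(t))_{i_t}, defined on matrices X ∈ ℝ^{D×N} with columns x(1), …, x(N), is Lipschitz with respect to the supremum norm with constant N·λ·√D: for all X, Y ∈ ℝ^{D×N}, |f(X) − f(Y)| ≤ N·λ·√D·max_{1≤t≤N} ‖x(t) − y(t)‖_∞. -/

import Mathlib

/-- Softmax with inverse temperature `lam` on `ℝ^D`:
`softmax(x)_i = exp(lam·x_i) / ∑_j exp(lam·x_j)`. -/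
noncomputable def softmaxFin {D : ℕ} (lam : ℝ) (x : Fin D → ℝ) (i : Fin D) : ℝ :=
  Real.exp (lam * x i) / ∑ j, Real.exp (lam * x j)

theorem softmaxFin_nonneg {D : ℕ} (lam : ℝ) (x : Fin D → ℝ) (i : Fin D) :
    0 ≤ softmaxFin lam x i := by
  unfold softmaxFin
  positivity

theorem one_sub_softmaxFin {D : ℕ} (lam : ℝ) (x : Fin D → ℝ) (i : Fin D) :
    1 - softmaxFin lam x i =
      (∑ j ∈ Finset.univ.erase i, Real.exp (lam * x j)) / ∑ j, Real.exp (lam * x j) := by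
  have hS : 0 < ∑ j, Real.exp (lam * x j) :=
    Finset.sum_pos (fun _ _ => Real.exp_pos _) ⟨i, Finset.mem_univ i⟩
  have h := Finset.add_sum_erase Finset.univ (fun j => Real.exp (lam * x j)) (Finset.mem_univ i)
  unfold softmaxFin
  rw [eq_div_iff hS.ne', sub_mul, div_mul_cancel₀ _ hS.ne']
  linarith

theorem softmaxFin_le_one {D : ℕ} (lam : ℝ) (x : Fin D → ℝ) (i : Fin D) :
    softmaxFin lam x i ≤ 1 := by
  rw [← sub_nonneg, one_sub_softmaxFin]
  positivity

/-- Perturbing the input changes the odds of a softmax coordinate by a bounded factor. -/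
theorem softmaxFin_mul_one_sub_le {D : ℕ} {lam : ℝ} (hlam : 0 < lam) (x y : Fin D → ℝ)
    (i : Fin D) :
    softmaxFin lam x i * (1 - softmaxFin lam y i) ≤
      Real.exp (lam * ‖x - y‖) ^ 2 * (softmaxFin lam y i * (1 - softmaxFin lam x i)) := by
  have key : Real.exp (lam * x i) * ∑ j ∈ Finset.univ.erase i, Real.exp (lam * y j) ≤
      Real.exp (lam * ‖x - y‖) ^ 2 *
        (Real.exp (lam * y i) * ∑ j ∈ Finset.univ.erase i, Real.exp (lam * x j)) := by
    simp only [Finset.mul_sum]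
    refine Finset.sum_le_sum fun j _ => ?_
    rw [sq, ← Real.exp_add, ← Real.exp_add, ← Real.exp_add, ← Real.exp_add, Real.exp_le_exp]
    have hi := (abs_le.1 (norm_le_pi_norm (x - y) i)).2
    have hj := (abs_le.1 (norm_le_pi_norm (x - y) j)).1
    simp only [Pi.sub_apply] at hi hj
    have := mul_le_mul_of_nonneg_left
      (show x i + y j ≤ ‖x - y‖ + ‖x - y‖ + (y i + x j) by linarith) hlam.le
    linarith
  rw [one_sub_softmaxFin, one_sub_softmaxFin]
  unfold softmaxFin
  calc _ = (Real.exp (lam * x i) * ∑ j ∈ Finset.univ.erase i, Real.exp (lam * y j)) /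
        ((∑ j, Real.exp (lam * x j)) * ∑ j, Real.exp (lam * y j)) := div_mul_div_comm _ _ _ _
    _ ≤ _ := div_le_div_of_nonneg_right key (by positivity)
    _ = _ := by rw [div_mul_div_comm, mul_div_assoc,
                  mul_comm (∑ j, Real.exp (lam * x j)) (∑ j, Real.exp (lam * y j))]

theorem sub_le_of_mul_one_sub_le {p q r : ℝ} (hp : 0 ≤ p) (hp1 : p ≤ 1) (hq : 0 ≤ q)
    (hq1 : q ≤ 1) (hr : 0 ≤ r) (h : p * (1 - q) ≤ Real.exp r ^ 2 * (q * (1 - p))) :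
    p - q ≤ r := by
  have ha : 0 ≤ p * (1 - q) := mul_nonneg hp (sub_nonneg.2 hq1)
  have hb : 0 ≤ q * (1 - p) := mul_nonneg hq (sub_nonneg.2 hp1)
  obtain ⟨a, ha0, ha2⟩ : ∃ a, 0 ≤ a ∧ a ^ 2 = p * (1 - q) :=
    ⟨_, Real.sqrt_nonneg _, Real.sq_sqrt ha⟩
  obtain ⟨b, hb0, hb2⟩ : ∃ b, 0 ≤ b ∧ b ^ 2 = q * (1 - p) :=
    ⟨_, Real.sqrt_nonneg _, Real.sq_sqrt hb⟩
  have hab : a + b ≤ 1 := by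
    have h1 : a * b ≤ (p * (1 - p) + q * (1 - q)) / 2 := by
      refine abs_le_of_sq_le_sq' ?_ ?_ |>.2
      · rw [mul_pow, ha2, hb2]
        nlinarith [sq_nonneg (p * (1 - p) - q * (1 - q))]
      · nlinarith [mul_nonneg hp (sub_nonneg.2 hp1), mul_nonneg hq (sub_nonneg.2 hq1)]
    nlinarith [sq_nonneg (p + q - 1)]
  have hle : a ≤ Real.exp r * b := by
    refine (abs_le_of_sq_le_sq' ?_ (by positivity)).2
    rw [mul_pow, ha2, hb2]
    exact h
  have hdiff : a - b ≤ r * a := by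
    have h1 : Real.exp (-r) * a ≤ b := by
      rw [Real.exp_neg, inv_mul_le_iff₀ (Real.exp_pos r)]
      exact hle
    nlinarith [Real.add_one_le_exp (-r)]
  have hr1 : r * a ≤ r := mul_le_of_le_one_right hr (by linarith)
  calc p - q = (a - b) * (a + b) := by linear_combination hb2 - ha2
    _ ≤ r * (a + b) := mul_le_mul_of_nonneg_right (hdiff.trans hr1) (by positivity)
    _ ≤ r := mul_le_of_le_one_right hr hab

/-- Each coordinate of softmax is `lam`-Lipschitz for the supremum norm. -/
theorem abs_softmaxFin_sub_le {D : ℕ} {lam : ℝ} (hlam : 0 < lam) (x y : Fin D → ℝ)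
    (i : Fin D) :
    |softmaxFin lam x i - softmaxFin lam y i| ≤ lam * ‖x - y‖ := by
  have h (u v : Fin D → ℝ) : softmaxFin lam u i - softmaxFin lam v i ≤ lam * ‖u - v‖ :=
    sub_le_of_mul_one_sub_le (softmaxFin_nonneg _ _ _) (softmaxFin_le_one _ _ _)
      (softmaxFin_nonneg _ _ _) (softmaxFin_le_one _ _ _) (by positivity)
      (softmaxFin_mul_one_sub_le hlam u v i)
  rw [abs_sub_le_iff]
  exact ⟨h x y, norm_sub_rev x y ▸ h y x⟩

theorem Finset.abs_prod_sub_prod_le_sum {ι : Type*} (s : Finset ι) (a b : ι → ℝ)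
    (ha : ∀ i, 0 ≤ a i) (ha1 : ∀ i, a i ≤ 1) (hb : ∀ i, 0 ≤ b i) (hb1 : ∀ i, b i ≤ 1) :
    |∏ i ∈ s, a i - ∏ i ∈ s, b i| ≤ ∑ i ∈ s, |a i - b i| := by
  classical
  induction s using Finset.induction_on with
  | empty => simp
  | insert i s hi ih =>
    rw [Finset.prod_insert hi, Finset.prod_insert hi, Finset.sum_insert hi]
    have hP : |∏ j ∈ s, a j| ≤ 1 := by
      rw [abs_of_nonneg (Finset.prod_nonneg fun j _ => ha j)]
      exact Finset.prod_le_one (fun j _ => ha j) fun j _ => ha1 j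
    have hbi : |b i| ≤ 1 := by
      rw [abs_of_nonneg (hb i)]
      exact hb1 i
    calc |a i * ∏ j ∈ s, a j - b i * ∏ j ∈ s, b j|
        = |(a i - b i) * ∏ j ∈ s, a j + b i * (∏ j ∈ s, a j - ∏ j ∈ s, b j)| := by
          congr 1
          ring
      _ ≤ |a i - b i| * |∏ j ∈ s, a j| + |b i| * |∏ j ∈ s, a j - ∏ j ∈ s, b j| := by
          rw [← abs_mul, ← abs_mul]
          exact abs_add_le _ _
      _ ≤ |a i - b i| + ∑ j ∈ s, |a j - b j| :=
          add_le_add (mul_le_of_le_one_right (abs_nonneg _) hP)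
            ((mul_le_of_le_one_left (abs_nonneg _) hbi).trans ih)

/-- For `N ≥ 1`, `lam > 0` and coordinate indices `idx t ∈ Fin D`, the
function `X ↦ ∏_{t} softmax(x(t))_{idx t}` on `D × N` matrices (with columns `x(t)`) is
Lipschitz with constant `N·lam·√D` with respect to the supremum norm:
`|f(X) − f(Y)| ≤ N·lam·√D · max_t ‖x(t) − y(t)‖_∞`. -/
theorem product_of_softmaxes_lipschitz (D N : ℕ) (hN : 1 ≤ N) (lam : ℝ) (hlam : 0 < lam)
    (idx : Fin N → Fin D) (X Y : Matrix (Fin D) (Fin N) ℝ) :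
    |(∏ t, softmaxFin lam (fun d => X d t) (idx t)) -
        (∏ t, softmaxFin lam (fun d => Y d t) (idx t))| ≤
      (N : ℝ) * lam * Real.sqrt D *
        Finset.univ.sup' (Finset.univ_nonempty_iff.mpr ⟨⟨0, hN⟩⟩)
          (fun t : Fin N => ‖(fun d => X d t - Y d t : Fin D → ℝ)‖) := by
  set M := Finset.univ.sup' (Finset.univ_nonempty_iff.mpr ⟨⟨0, hN⟩⟩)
    (fun t : Fin N => ‖(fun d => X d t - Y d t : Fin D → ℝ)‖)
  have hle (t : Fin N) : ‖(fun d => X d t - Y d t : Fin D → ℝ)‖ ≤ M :=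
    Finset.le_sup' (fun t : Fin N => ‖(fun d => X d t - Y d t : Fin D → ℝ)‖) (Finset.mem_univ t)
  have hM0 : 0 ≤ M := (norm_nonneg _).trans (hle ⟨0, hN⟩)
  have hD : 1 ≤ Real.sqrt D :=
    Real.one_le_sqrt.2 (by exact_mod_cast (Nat.zero_le _).trans_lt (idx ⟨0, hN⟩).isLt)
  calc _ ≤ ∑ t, |softmaxFin lam (fun d => X d t) (idx t) -
          softmaxFin lam (fun d => Y d t) (idx t)| :=
        Finset.abs_prod_sub_prod_le_sum _ _ _ (fun _ => softmaxFin_nonneg _ _ _)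
          (fun _ => softmaxFin_le_one _ _ _) (fun _ => softmaxFin_nonneg _ _ _)
          (fun _ => softmaxFin_le_one _ _ _)
    _ ≤ ∑ _t : Fin N, lam * M :=
        Finset.sum_le_sum fun t _ => (abs_softmaxFin_sub_le hlam _ _ _).trans
          (mul_le_mul_of_nonneg_left (hle t) hlam.le)
    _ = N * lam * 1 * M := by simp [mul_assoc]
    _ ≤ N * lam * Real.sqrt D * M := by gcongr
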